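/- Let Φ(x) = 2(1 − 1/x)^{x−1} Γ(1/2 + x/2) Γ(x) / (Γ(1 + x/2) Γ(−1/2 + x)) for real x > 1. Then Φ(x) > 1 for every x > 1 with x ≠ 2, and Φ(2) = 1. -/

import Mathlib

noncomputable def Phi (x : ℝ) : ℝ :=
  2 * (1 - 1 / x) ^ (x - 1) * (Real.Gamma (1/2 + x/2) * Real.Gamma x) /
    (Real.Gamma (1 + x/2) * Real.Gamma (-1/2 + x))

open Real Set Filter Topology

/-- The logarithm of the Gamma quotient occurring in `Phi`. -/
noncomputable def logGammaQuot (x : ℝ) : ℝ :=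
  log (Gamma (1/2 + x/2)) + log (Gamma x) - log (Gamma (1 + x/2)) - log (Gamma (-1/2 + x))

/-- The logarithm of `Phi`, see `Phi_eq_exp_logPhi`. -/
noncomputable def logPhi (x : ℝ) : ℝ :=
  log 2 + (x - 1) * (log (x - 1) - log x) + logGammaQuot x

/-- The decrement `logGammaQuot x - logGammaQuot (x + 2)` in elementary form. -/
noncomputable def logGammaQuotStep (x : ℝ) : ℝ :=
  log (x + 2) + log (x - 1/2) + log (x + 1/2) - log x - 2 * log (x + 1)

theorem Phi_eq_exp_logPhi {x : ℝ} (hx : 1 < x) : Phi x = exp (logPhi x) := by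
  have h0 : 0 < x := by linarith
  have h1 : 0 < 1 - 1 / x := by
    rw [sub_pos, div_lt_one h0]; exact hx
  have hlog : log (x - 1) - log x = log (1 - 1 / x) := by
    rw [← log_div (by linarith) h0.ne']
    congr 1
    field_simp
  have g1 := Gamma_pos_of_pos (show 0 < 1/2 + x/2 by linarith)
  have g2 := Gamma_pos_of_pos h0
  have g3 := Gamma_pos_of_pos (show 0 < 1 + x/2 by linarith)
  have g4 := Gamma_pos_of_pos (show 0 < -1/2 + x by linarith)
  have hP : 0 < Phi x := by
    unfold Phi
    positivity
  rw [← exp_log hP]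
  congr 1
  unfold Phi logPhi logGammaQuot
  rw [log_div (by positivity) (by positivity), log_mul (by positivity) (by positivity),
    log_mul (by positivity) (by positivity), log_mul (by positivity) (by positivity),
    log_mul (by positivity) (by positivity), log_rpow h1, hlog]
  ring

theorem Phi_two : Phi 2 = 1 := by
  have h1 : (1:ℝ)/2 + 2/2 = -1/2 + 2 := by norm_num
  have h2 : (1:ℝ) + 2/2 = 2 := by norm_num
  have h3 : ((2:ℝ) - 1) = 1 := by norm_num
  have g := (Gamma_pos_of_pos (show (0:ℝ) < -1/2 + 2 by norm_num)).ne'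
  unfold Phi
  rw [h1, h2, h3, rpow_one, Gamma_two]
  field_simp
  norm_num

theorem log_Gamma_add_one {x : ℝ} (hx : 0 < x) :
    log (Gamma (x + 1)) = log x + log (Gamma x) := by
  rw [Gamma_add_one hx.ne', log_mul hx.ne' (Gamma_pos_of_pos hx).ne']

theorem logGammaQuot_sub_add_two {x : ℝ} (hx : 1 < x) :
    logGammaQuot x - logGammaQuot (x + 2) = logGammaQuotStep x := by
  unfold logGammaQuot logGammaQuotStep
  have e1 := log_Gamma_add_one (show 0 < 1/2 + x/2 by linarith)
  have e2 := log_Gamma_add_one (show 0 < x by linarith)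
  have e3 := log_Gamma_add_one (show 0 < x + 1 by linarith)
  have e4 := log_Gamma_add_one (show 0 < 1 + x/2 by linarith)
  have e5 := log_Gamma_add_one (show 0 < -1/2 + x by linarith)
  have e6 := log_Gamma_add_one (show 0 < -1/2 + x + 1 by linarith)
  have l1 : log (1/2 + x/2) = log (x + 1) - log 2 := by
    rw [← log_div (by linarith) two_ne_zero]; congr 1; ring
  have l2 : log (1 + x/2) = log (x + 2) - log 2 := by
    rw [← log_div (by linarith) two_ne_zero]; congr 1; ring
  rw [show 1/2 + (x + 2)/2 = 1/2 + x/2 + 1 by ring, show 1 + (x + 2)/2 = 1 + x/2 + 1 by ring,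
    show x + 2 = x + 1 + 1 by ring, show -1/2 + (x + 1 + 1) = -1/2 + x + 1 + 1 by ring,
    e1, e3, e4, e6, e2, e5, l1, l2, show -1/2 + x = x - 1/2 by ring,
    show x - 1/2 + 1 = x + 1/2 by ring, show x + 1 + 1 = x + 2 by ring]
  ring

theorem log_Gamma_add_half_sub_le {x : ℝ} (hx : 0 < x) :
    log (Gamma (x + 1/2)) - log (Gamma x) ≤ log x / 2 := by
  have h := convexOn_log_Gamma.2 (mem_Ioi.2 hx) (mem_Ioi.2 (show 0 < x + 1 by linarith))
    (show (0:ℝ) ≤ 1/2 by norm_num) (show (0:ℝ) ≤ 1/2 by norm_num) (by norm_num)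
  simp only [smul_eq_mul, Function.comp] at h
  rw [log_Gamma_add_one hx, show 1/2 * x + 1/2 * (x + 1) = x + 1/2 by ring] at h
  linarith

theorem le_log_Gamma_add_half_sub {x : ℝ} (hx : 1/2 < x) :
    log (x - 1/2) / 2 ≤ log (Gamma (x + 1/2)) - log (Gamma x) := by
  have h0 : 0 < x - 1/2 := by linarith
  have h := log_Gamma_add_half_sub_le h0
  have h' := log_Gamma_add_one h0
  rw [show x - 1/2 + 1 = x + 1/2 by ring] at h'
  rw [show x - 1/2 + 1/2 = x by ring] at h
  linarith

theorem tendsto_logGammaQuot : Tendsto logGammaQuot atTop (𝓝 (log 2 / 2)) := by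
  have hlow : Tendsto (fun x : ℝ => log (2 - 4 / (x + 1)) / 2) atTop (𝓝 (log 2 / 2)) := by
    have h : Tendsto (fun x : ℝ => 2 - 4 / (x + 1)) atTop (𝓝 (2 - 0)) :=
      tendsto_const_nhds.sub
        (tendsto_const_nhds.div_atTop (tendsto_atTop_add_const_right _ _ tendsto_id))
    rw [sub_zero] at h
    exact (h.log two_ne_zero).div_const 2
  have hup : Tendsto (fun x : ℝ => log (2 - 1 / x) / 2) atTop (𝓝 (log 2 / 2)) := by
    have h : Tendsto (fun x : ℝ => 2 - 1 / x) atTop (𝓝 (2 - 0)) :=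
      tendsto_const_nhds.sub (tendsto_const_nhds.div_atTop tendsto_id)
    rw [sub_zero] at h
    exact (h.log two_ne_zero).div_const 2
  refine tendsto_of_tendsto_of_tendsto_of_le_of_le' hlow hup ?_ ?_
  · filter_upwards [eventually_gt_atTop 1] with x hx
    have h1 := le_log_Gamma_add_half_sub (show 1/2 < -1/2 + x by linarith)
    have h2 := log_Gamma_add_half_sub_le (show 0 < 1/2 + x/2 by linarith)
    rw [show 1/2 + x/2 + 1/2 = 1 + x/2 by ring] at h2
    rw [show -1/2 + x + 1/2 = x by ring] at h1
    have e : log (2 - 4 / (x + 1)) = log (-1/2 + x - 1/2) - log (1/2 + x/2) := by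
      rw [← log_div (by linarith) (by linarith)]
      congr 1
      have : x + 1 ≠ 0 := by linarith
      have : 1/2 + x/2 ≠ 0 := by linarith
      field_simp
      ring
    unfold logGammaQuot
    linarith
  · filter_upwards [eventually_gt_atTop 1] with x hx
    have h1 := log_Gamma_add_half_sub_le (show 0 < -1/2 + x by linarith)
    have h2 := le_log_Gamma_add_half_sub (show 1/2 < 1/2 + x/2 by linarith)
    rw [show 1/2 + x/2 + 1/2 = 1 + x/2 by ring] at h2
    rw [show -1/2 + x + 1/2 = x by ring] at h1
    have e : log (2 - 1 / x) = log (-1/2 + x) - log (1/2 + x/2 - 1/2) := by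
      rw [← log_div (by linarith) (by linarith)]
      congr 1
      have : x ≠ 0 := by linarith
      rw [show 1/2 + x/2 - 1/2 = x/2 by ring]
      field_simp
      ring
    unfold logGammaQuot
    linarith

theorem tendsto_logPhi :
    Tendsto logPhi atTop (𝓝 (log 2 + (-1) + log 2 / 2)) := by
  refine Tendsto.add (tendsto_const_nhds.add ?_) tendsto_logGammaQuot
  have h := ((tendsto_mul_log_one_add_div_atTop 1).comp
    (tendsto_atTop_add_const_right atTop (-1 : ℝ) tendsto_id)).neg
  refine h.congr' ?_
  filter_upwards [eventually_gt_atTop 1] with x hx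
  have h0 : x - 1 ≠ 0 := by linarith
  have e : 1 + 1 / (x - 1) = x / (x - 1) := by field_simp; ring
  simp only [Function.comp, id, ← sub_eq_add_neg]
  rw [e, log_div (by linarith) h0]
  ring

section Descent

variable {f : ℝ → ℝ} {a c : ℝ}

theorem tendsto_comp_add_two_mul_nat (hf : Tendsto f atTop (𝓝 c)) (x : ℝ) :
    Tendsto (fun n : ℕ => f (x + 2 * n)) atTop (𝓝 c) :=
  hf.comp (tendsto_atTop_add_const_left _ _
    (tendsto_natCast_atTop_atTop.const_mul_atTop two_pos))

/-- A function with a limit at infinity is monotone if its increments of step `2` are antitone. -/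
theorem monotoneOn_of_antitoneOn_step (hf : Tendsto f atTop (𝓝 c))
    (h : AntitoneOn (fun x => f (x + 2) - f x) (Ici a)) : MonotoneOn f (Ici a) := by
  intro x hx y hy hxy
  rw [mem_Ici] at hx hy
  have hanti : Antitone fun n : ℕ => f (y + 2 * n) - f (x + 2 * n) := by
    refine antitone_nat_of_succ_le fun n => ?_
    have hn : (0:ℝ) ≤ n := n.cast_nonneg
    have := h (mem_Ici.2 (show a ≤ x + 2 * n by linarith))
      (mem_Ici.2 (show a ≤ y + 2 * n by linarith)) (by linarith)
    simp only at this
    push_cast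
    rw [show y + 2 * ((n:ℝ) + 1) = y + 2 * n + 2 by ring,
      show x + 2 * ((n:ℝ) + 1) = x + 2 * n + 2 by ring]
    linarith
  have hlim := (tendsto_comp_add_two_mul_nat hf y).sub (tendsto_comp_add_two_mul_nat hf x)
  have := hanti.le_of_tendsto hlim 0
  simp only [Nat.cast_zero, mul_zero, add_zero, sub_self] at this
  linarith

/-- A function with a limit at infinity is convex if its decrements of step `2` are convex. -/
theorem convexOn_of_convexOn_step (hf : Tendsto f atTop (𝓝 c))
    (h : ConvexOn ℝ (Ici a) fun x => f x - f (x + 2)) : ConvexOn ℝ (Ici a) f := by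
  refine ⟨convex_Ici a, fun x hx y hy s t hs ht hst => ?_⟩
  rw [mem_Ici] at hx hy
  simp only [smul_eq_mul]
  have hanti : Antitone fun n : ℕ =>
      s * f (x + 2 * n) + t * f (y + 2 * n) - f (s * x + t * y + 2 * n) := by
    refine antitone_nat_of_succ_le fun n => ?_
    have hn : (0:ℝ) ≤ n := n.cast_nonneg
    have := h.2 (mem_Ici.2 (show a ≤ x + 2 * n by linarith))
      (mem_Ici.2 (show a ≤ y + 2 * n by linarith)) hs ht hst
    simp only [smul_eq_mul] at this
    rw [show s * (x + 2 * n) + t * (y + 2 * n) = s * x + t * y + 2 * n by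
      linear_combination 2 * (n:ℝ) * hst] at this
    push_cast
    rw [show y + 2 * ((n:ℝ) + 1) = y + 2 * n + 2 by ring,
      show x + 2 * ((n:ℝ) + 1) = x + 2 * n + 2 by ring,
      show s * x + t * y + 2 * ((n:ℝ) + 1) = s * x + t * y + 2 * n + 2 by ring]
    linarith
  have hlim := (((tendsto_comp_add_two_mul_nat hf x).const_mul s).add
    ((tendsto_comp_add_two_mul_nat hf y).const_mul t)).sub
      (tendsto_comp_add_two_mul_nat hf (s * x + t * y))
  have := hanti.le_of_tendsto hlim 0
  simp only [Nat.cast_zero, mul_zero, add_zero, ← add_mul, hst, one_mul, sub_self] at this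
  linarith

end Descent

theorem hasDerivAt_log_add (a : ℝ) {x : ℝ} (hx : x + a ≠ 0) :
    HasDerivAt (fun y => log (y + a)) (1 / (x + a)) x :=
  ((hasDerivAt_id x).add_const a).log hx

theorem hasDerivAt_inv_add (a : ℝ) {x : ℝ} (hx : x + a ≠ 0) :
    HasDerivAt (fun y => 1 / (y + a)) (-1 / (x + a) ^ 2) x := by
  simpa using ((hasDerivAt_id x).add_const a).fun_inv hx

theorem hasDerivAt_logGammaQuotStep {x : ℝ} (hx : 1/2 < x) :
    HasDerivAt logGammaQuotStep
      (1 / (x + 2) + 1 / (x - 1/2) + 1 / (x + 1/2) - 1 / x - 2 * (1 / (x + 1))) x := by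
  have h1 := hasDerivAt_log_add 2 (show x + 2 ≠ 0 by linarith)
  have h2 := hasDerivAt_log_add (-(1/2)) (show x + -(1/2) ≠ 0 by linarith)
  have h3 := hasDerivAt_log_add (1/2) (show x + 1/2 ≠ 0 by linarith)
  have h4 := hasDerivAt_log (show x ≠ 0 by linarith)
  have h5 := hasDerivAt_log_add 1 (show x + 1 ≠ 0 by linarith)
  simp only [← sub_eq_add_neg] at h2
  rw [← one_div] at h4
  exact (((h1.add h2).add h3).sub h4).sub (h5.const_mul 2)

theorem hasDerivAt_deriv_logGammaQuotStep {x : ℝ} (hx : 1/2 < x) :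
    HasDerivAt
      (fun x => 1 / (x + 2) + 1 / (x - 1/2) + 1 / (x + 1/2) - 1 / x - 2 * (1 / (x + 1)))
      (-1 / (x + 2) ^ 2 + -1 / (x - 1/2) ^ 2 + -1 / (x + 1/2) ^ 2 - -1 / x ^ 2
        - 2 * (-1 / (x + 1) ^ 2)) x := by
  have h1 := hasDerivAt_inv_add 2 (show x + 2 ≠ 0 by linarith)
  have h2 := hasDerivAt_inv_add (-(1/2)) (show x + -(1/2) ≠ 0 by linarith)
  have h3 := hasDerivAt_inv_add (1/2) (show x + 1/2 ≠ 0 by linarith)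
  have h4 := hasDerivAt_inv_add 0 (show x + 0 ≠ 0 by linarith)
  have h5 := hasDerivAt_inv_add 1 (show x + 1 ≠ 0 by linarith)
  simp only [← sub_eq_add_neg] at h2
  simp only [add_zero] at h4
  exact (((h1.add h2).add h3).sub h4).sub (h5.const_mul 2)

theorem hasDerivAt_inv_add_sq (a : ℝ) {x : ℝ} (hx : x + a ≠ 0) :
    HasDerivAt (fun y => -1 / (y + a) ^ 2) (2 / (x + a) ^ 3) x := by
  have h := (((hasDerivAt_id x).add_const a).fun_pow 2).fun_inv (pow_ne_zero 2 hx)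
  simp only [id, ← one_div] at h
  refine ((h.const_mul (-1)).congr_deriv ?_).congr_of_eventuallyEq (.of_forall fun y => ?_)
  · field_simp
    norm_num
    ring
  · ring

theorem log_one_add_le {u : ℝ} (hu : 0 ≤ u) : log (1 + u) ≤ u * (6 + u) / (6 + 4 * u) := by
  have hd : ∀ y : ℝ, 0 ≤ y → HasDerivAt (fun u => u * (6 + u) / (6 + 4 * u) - log (1 + u))
      (4 * y ^ 3 / ((6 + 4 * y) ^ 2 * (1 + y))) y := by
    intro y hy
    have hn : HasDerivAt (fun u : ℝ => u * (6 + u)) (1 * (6 + y) + y * 1) y :=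
      (hasDerivAt_id y).mul ((hasDerivAt_id y).const_add 6)
    have hde : HasDerivAt (fun u : ℝ => 6 + 4 * u) (4 * 1) y :=
      ((hasDerivAt_id y).const_mul 4).const_add 6
    have hl : HasDerivAt (fun u : ℝ => log (1 + u)) (1 / (1 + y)) y :=
      ((hasDerivAt_id y).const_add 1).log (by simp only [id]; linarith)
    have h6 : 6 + 4 * y ≠ 0 := by linarith
    have h1 : 1 + y ≠ 0 := by linarith
    refine ((hn.fun_div hde h6).fun_sub hl).congr_deriv ?_
    field_simp
    ring
  have hmono : MonotoneOn (fun u => u * (6 + u) / (6 + 4 * u) - log (1 + u)) (Ici (0:ℝ)) := by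
    refine monotoneOn_of_hasDerivWithinAt_nonneg (convex_Ici 0)
      (fun y hy => (hd y hy).continuousAt.continuousWithinAt)
      (fun y hy => (hd y (interior_subset hy)).hasDerivWithinAt) fun y hy => ?_
    have : 0 ≤ y := interior_subset hy
    positivity
  have := hmono self_mem_Ici (mem_Ici.2 hu) hu
  simp only [zero_mul, zero_div, add_zero, log_one, sub_self] at this
  linarith

theorem logGammaQuotStep_deriv2_add_nonneg {x : ℝ} (hx : 3 ≤ x) :
    0 ≤ -1 / (x + 2) ^ 2 + -1 / (x - 1/2) ^ 2 + -1 / (x + 1/2) ^ 2 - -1 / x ^ 2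
      - 2 * (-1 / (x + 1) ^ 2) + 5/8 * (2 / (x - 1/4) ^ 3) - 5/8 * (2 / (x + 7/4) ^ 3) := by
  have h1 : 0 < x := by linarith
  have h2 : 0 < x - 1/2 := by linarith
  have h3 : 0 < x - 1/4 := by linarith
  have h4 : 0 ≤ x - 3 := by linarith
  have h5 : x * 2 - 1 ≠ 0 := by linarith
  have h6 : x * 4 - 1 ≠ 0 := by linarith
  have key : -1 / (x + 2) ^ 2 + -1 / (x - 1/2) ^ 2 + -1 / (x + 1/2) ^ 2 - -1 / x ^ 2
      - 2 * (-1 / (x + 1) ^ 2) + 5/8 * (2 / (x - 1/4) ^ 3) - 5/8 * (2 / (x + 7/4) ^ 3) =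
      (58782801625 + 190830386280 * (x - 3) + 278452174074 * (x - 3) ^ 2
        + 241161953106 * (x - 3) ^ 3 + 137788771841 * (x - 3) ^ 4 + 54545568360 * (x - 3) ^ 5
        + 15268777268 * (x - 3) ^ 6 + 3022890144 * (x - 3) ^ 7 + 414870720 * (x - 3) ^ 8
        + 37598208 * (x - 3) ^ 9 + 2025472 * (x - 3) ^ 10 + 49152 * (x - 3) ^ 11) / 32768 /
      (x ^ 2 * (x + 1) ^ 2 * (x + 2) ^ 2 * (x - 1/2) ^ 2 * (x + 1/2) ^ 2
        * (x - 1/4) ^ 3 * (x + 7/4) ^ 3) := by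
    field_simp
    ring
  rw [key]
  positivity

theorem convexOn_logGammaQuot_add_inv :
    ConvexOn ℝ (Ici 3) fun x => logGammaQuot x + 5/8 * (1 / (x - 1/4)) := by
  have hlim : Tendsto (fun x : ℝ => logGammaQuot x + 5/8 * (1 / (x - 1/4))) atTop
      (𝓝 (log 2 / 2 + 5/8 * 0)) :=
    tendsto_logGammaQuot.add ((tendsto_const_nhds.div_atTop
      (tendsto_atTop_add_const_right _ (-(1/4)) tendsto_id)).const_mul _)
  refine convexOn_of_convexOn_step hlim ?_
  have hd : ∀ x ∈ Ici (3:ℝ), HasDerivAt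
      (fun x => logGammaQuotStep x + 5/8 * (1 / (x - 1/4)) - 5/8 * (1 / (x + 7/4)))
      (1 / (x + 2) + 1 / (x - 1/2) + 1 / (x + 1/2) - 1 / x - 2 * (1 / (x + 1))
        + 5/8 * (-1 / (x - 1/4) ^ 2) - 5/8 * (-1 / (x + 7/4) ^ 2)) x := by
    intro x hx
    rw [mem_Ici] at hx
    have h1 := hasDerivAt_logGammaQuotStep (show 1/2 < x by linarith)
    have h2 := hasDerivAt_inv_add (-(1/4)) (show x + -(1/4) ≠ 0 by linarith)
    have h3 := hasDerivAt_inv_add (7/4) (show x + 7/4 ≠ 0 by linarith)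
    simp only [← sub_eq_add_neg] at h2
    exact (h1.add (h2.const_mul _)).sub (h3.const_mul _)
  have hd2 : ∀ x ∈ Ici (3:ℝ), HasDerivAt
      (fun x => 1 / (x + 2) + 1 / (x - 1/2) + 1 / (x + 1/2) - 1 / x - 2 * (1 / (x + 1))
        + 5/8 * (-1 / (x - 1/4) ^ 2) - 5/8 * (-1 / (x + 7/4) ^ 2))
      (-1 / (x + 2) ^ 2 + -1 / (x - 1/2) ^ 2 + -1 / (x + 1/2) ^ 2 - -1 / x ^ 2
        - 2 * (-1 / (x + 1) ^ 2) + 5/8 * (2 / (x - 1/4) ^ 3) - 5/8 * (2 / (x + 7/4) ^ 3)) x := by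
    intro x hx
    rw [mem_Ici] at hx
    have h1 := hasDerivAt_deriv_logGammaQuotStep (show 1/2 < x by linarith)
    have h2 := hasDerivAt_inv_add_sq (-(1/4)) (show x + -(1/4) ≠ 0 by linarith)
    have h3 := hasDerivAt_inv_add_sq (7/4) (show x + 7/4 ≠ 0 by linarith)
    simp only [← sub_eq_add_neg] at h2
    exact (h1.add (h2.const_mul _)).sub (h3.const_mul _)
  have hconv := convexOn_of_hasDerivWithinAt2_nonneg (convex_Ici 3)
    (fun x hx => (hd x hx).continuousAt.continuousWithinAt)
    (fun x hx => (hd x (interior_subset hx)).hasDerivWithinAt)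
    (fun x hx => (hd2 x (interior_subset hx)).hasDerivWithinAt)
    (fun x hx => logGammaQuotStep_deriv2_add_nonneg (interior_subset hx))
  refine hconv.congr fun x hx => ?_
  rw [mem_Ici] at hx
  simp only
  rw [← logGammaQuot_sub_add_two (by linarith), show x + 2 - 1/4 = x + 7/4 by ring]
  ring

theorem elementary_part_deriv2_pos {x : ℝ} (hx : 1 < x) (hx' : x ≤ 5/2) :
    0 < 1 / (x - 1) - 1 / x + -1 / x ^ 2 + (-1 / (x + 2) ^ 2 + -1 / (x - 1/2) ^ 2
      + -1 / (x + 1/2) ^ 2 - -1 / x ^ 2 - 2 * (-1 / (x + 1) ^ 2))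
      - 5/8 * (2 / (x + 7/4) ^ 3) := by
  have h1 : 0 < x := by linarith
  have h2 : 0 < x - 1/2 := by linarith
  have h3 : 0 < x - 1 := by linarith
  have h4 : 0 ≤ 5/2 - x := by linarith
  have h5 : x * 2 - 1 ≠ 0 := by linarith
  have key : 1 / (x - 1) - 1 / x + -1 / x ^ 2 + (-1 / (x + 2) ^ 2 + -1 / (x - 1/2) ^ 2
      + -1 / (x + 1/2) ^ 2 - -1 / x ^ 2 - 2 * (-1 / (x + 1) ^ 2))
      - 5/8 * (2 / (x + 7/4) ^ 3) =
      (127776 * (5/2 - x) ^ 10 + 2039672 * (x - 1) * (5/2 - x) ^ 9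
        + 14488686 * (x - 1) ^ 2 * (5/2 - x) ^ 8 + 60110141 * (x - 1) ^ 3 * (5/2 - x) ^ 7
        + 160603370 * (x - 1) ^ 4 * (5/2 - x) ^ 6 + 287050101 * (x - 1) ^ 5 * (5/2 - x) ^ 5
        + 344544943 * (x - 1) ^ 6 * (5/2 - x) ^ 4 + 270313936 * (x - 1) ^ 7 * (5/2 - x) ^ 3
        + 129107445 * (x - 1) ^ 8 * (5/2 - x) ^ 2 + 31823462 * (x - 1) ^ 9 * (5/2 - x)
        + 2460718 * (x - 1) ^ 10) / 17496 /
      (x * (x - 1) * (x + 1) ^ 2 * (x + 2) ^ 2 * (x - 1/2) ^ 2 * (x + 1/2) ^ 2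
        * (x + 7/4) ^ 3) := by
    field_simp
    ring
  rw [key]
  positivity

theorem strictConvexOn_of_hasDerivAt2_pos {D : Set ℝ} (hD : Convex ℝ D) {f f' f'' : ℝ → ℝ}
    (hf : ∀ x ∈ D, HasDerivAt f (f' x) x) (hf' : ∀ x ∈ D, HasDerivAt f' (f'' x) x)
    (hpos : ∀ x ∈ D, 0 < f'' x) : StrictConvexOn ℝ D f := by
  refine strictConvexOn_of_deriv2_pos hD
    (fun x hx => (hf x hx).continuousAt.continuousWithinAt) fun x hx => ?_
  have hev : deriv f =ᶠ[𝓝 x] f' := by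
    filter_upwards [isOpen_interior.mem_nhds hx] with y hy
    exact (hf y (interior_subset hy)).deriv
  simp only [Function.iterate_succ, Function.iterate_zero, Function.comp, id]
  rw [hev.deriv_eq, (hf' x (interior_subset hx)).deriv]
  exact hpos x (interior_subset hx)

theorem strictConvexOn_logPhi : StrictConvexOn ℝ (Ioc 1 (5/2)) logPhi := by
  have hd : ∀ x ∈ Ioc (1:ℝ) (5/2), HasDerivAt
      (fun x => log 2 + (x - 1) * (log (x - 1) - log x) + logGammaQuotStep x
        - 5/8 * (1 / (x + 7/4)))
      (log (x - 1) - log x + 1 / x + (1 / (x + 2) + 1 / (x - 1/2) + 1 / (x + 1/2) - 1 / x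
        - 2 * (1 / (x + 1))) - 5/8 * (-1 / (x + 7/4) ^ 2)) x := by
    intro x ⟨hx, _⟩
    have h1 := hasDerivAt_logGammaQuotStep (show 1/2 < x by linarith)
    have h3 := hasDerivAt_inv_add (7/4) (show x + 7/4 ≠ 0 by linarith)
    have h4 : HasDerivAt (fun x : ℝ => x - 1) 1 x := (hasDerivAt_id x).sub_const 1
    have hx0 : x ≠ 0 := by linarith
    have hx1 : x - 1 ≠ 0 := by linarith
    have h5 := h4.fun_mul ((h4.log hx1).fun_sub (hasDerivAt_log hx0))
    refine (((h5.const_add (log 2)).fun_add h1).fun_sub (h3.const_mul _)).congr_deriv ?_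
    congr 2
    field_simp
    ring
  have hd2 : ∀ x ∈ Ioc (1:ℝ) (5/2), HasDerivAt
      (fun x => log (x - 1) - log x + 1 / x + (1 / (x + 2) + 1 / (x - 1/2) + 1 / (x + 1/2)
        - 1 / x - 2 * (1 / (x + 1))) - 5/8 * (-1 / (x + 7/4) ^ 2))
      (1 / (x - 1) - 1 / x + -1 / x ^ 2 + (-1 / (x + 2) ^ 2 + -1 / (x - 1/2) ^ 2
        + -1 / (x + 1/2) ^ 2 - -1 / x ^ 2 - 2 * (-1 / (x + 1) ^ 2))
        - 5/8 * (2 / (x + 7/4) ^ 3)) x := by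
    intro x ⟨hx, _⟩
    have h1 := hasDerivAt_deriv_logGammaQuotStep (show 1/2 < x by linarith)
    have h3 := hasDerivAt_inv_add_sq (7/4) (show x + 7/4 ≠ 0 by linarith)
    have h4 := hasDerivAt_log_add (-1) (show x + -1 ≠ 0 by linarith)
    have h5 := hasDerivAt_log_add 0 (show x + 0 ≠ 0 by linarith)
    have h6 := hasDerivAt_inv_add 0 (show x + 0 ≠ 0 by linarith)
    simp only [← sub_eq_add_neg] at h4
    simp only [add_zero] at h5 h6
    exact (((h4.fun_sub h5).fun_add h6).fun_add h1).fun_sub (h3.const_mul _)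
  have hA := strictConvexOn_of_hasDerivAt2_pos (convex_Ioc 1 (5/2)) hd hd2
    fun x hx => elementary_part_deriv2_pos hx.1 hx.2
  have hB : ConvexOn ℝ (Ioc 1 (5/2))
      fun x => logGammaQuot (x + 2) + 5/8 * (1 / (x + 2 - 1/4)) := by
    refine (convexOn_logGammaQuot_add_inv.translate_left 2).subset (fun x hx => ?_)
      (convex_Ioc _ _)
    rw [mem_preimage, mem_Ici]
    linarith [hx.1]
  refine (hA.add_convexOn hB).congr fun x hx => ?_
  have := logGammaQuot_sub_add_two hx.1
  simp only [Pi.add_apply, logPhi]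
  rw [← this, show x + 2 - 1/4 = x + 7/4 by ring]
  ring

theorem differentiableAt_Gamma_of_pos {x : ℝ} (hx : 0 < x) : DifferentiableAt ℝ Gamma x :=
  differentiableAt_Gamma fun m => ((neg_nonpos.mpr m.cast_nonneg).trans_lt hx).ne'

theorem hasDerivAt_Gamma_three_halves :
    HasDerivAt Gamma (√π / 2 * (2 - (eulerMascheroniConstant + 2 * log 2))) (3 / 2) := by
  have h1 : HasDerivAt Gamma (-√π * (eulerMascheroniConstant + 2 * log 2)) (3 / 2 - 1) := by
    rw [show (3:ℝ) / 2 - 1 = 1 / 2 by norm_num]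
    exact hasDerivAt_Gamma_one_half
  have h2 : HasDerivAt (fun x : ℝ => x - 1) 1 (3 / 2) := (hasDerivAt_id _).sub_const 1
  have h3 := h2.fun_mul (h1.comp (3 / 2) h2)
  refine (h3.congr_of_eventuallyEq ?_).congr_deriv ?_
  · filter_upwards [eventually_gt_nhds (show (1:ℝ) < 3 / 2 by norm_num)] with x hx
    rw [Function.comp, ← Gamma_add_one (by linarith), sub_add_cancel]
  · rw [Function.comp, show (3:ℝ) / 2 - 1 = 1 / 2 by norm_num, Gamma_one_half_eq]
    ring

theorem Gamma_three_halves : Gamma (3 / 2) = √π / 2 := by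
  rw [show (3:ℝ) / 2 = 1 / 2 + 1 by norm_num, Gamma_add_one (by norm_num), Gamma_one_half_eq]
  ring

theorem hasDerivAt_Gamma_two : HasDerivAt Gamma (1 - eulerMascheroniConstant) 2 := by
  have h := hasDerivAt_Gamma_nat 1
  norm_num at h
  rwa [neg_add_eq_sub] at h

theorem hasDerivAt_logPhi_two : HasDerivAt logPhi 0 2 := by
  have hπ : √π ≠ 0 := (sqrt_pos.2 pi_pos).ne'
  have a1 : HasDerivAt (fun x : ℝ => 1/2 + x/2) (1/2) 2 :=
    ((hasDerivAt_id _).div_const 2).const_add _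
  have a3 : HasDerivAt (fun x : ℝ => 1 + x/2) (1/2) 2 :=
    ((hasDerivAt_id _).div_const 2).const_add _
  have a4 : HasDerivAt (fun x : ℝ => -1/2 + x) 1 2 := (hasDerivAt_id _).const_add _
  have v1 : (1/2 + 2/2 : ℝ) = 3 / 2 := by norm_num
  have v3 : (1 + 2/2 : ℝ) = 2 := by norm_num
  have v4 : (-1/2 + 2 : ℝ) = 3 / 2 := by norm_num
  have G32 := Gamma_three_halves
  have G2 := Gamma_two
  have b1 := (HasDerivAt.comp (2:ℝ) (v1 ▸ hasDerivAt_Gamma_three_halves) a1).log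
    (by simp only [Function.comp, v1, G32]; positivity)
  have b2 := hasDerivAt_Gamma_two.log (by rw [G2]; exact one_ne_zero)
  have b3 := (HasDerivAt.comp (2:ℝ) (v3.symm ▸ hasDerivAt_Gamma_two) a3).log
    (by simp only [Function.comp, v3, G2]; exact one_ne_zero)
  have b4 := (HasDerivAt.comp (2:ℝ) (v4.symm ▸ hasDerivAt_Gamma_three_halves) a4).log
    (by simp only [Function.comp, v4, G32]; positivity)
  have c1 : HasDerivAt (fun x : ℝ => x - 1) 1 2 := (hasDerivAt_id _).sub_const 1
  have c2 := c1.fun_mul ((c1.log (by norm_num)).fun_sub (hasDerivAt_log (two_ne_zero' ℝ)))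
  refine ((c2.const_add (log 2)).fun_add (((b1.fun_add b2).fun_sub b3).fun_sub b4)).congr_deriv ?_
  simp only [Function.comp, v1, v3, v4, G32, G2]
  norm_num
  field_simp
  ring

theorem logPhi_two : logPhi 2 = 0 := by
  rw [← exp_eq_one_iff, ← Phi_eq_exp_logPhi one_lt_two, Phi_two]

theorem logPhi_pos_of_le {x : ℝ} (hx : 1 < x) (hx' : x ≤ 5/2) (h2 : x ≠ 2) : 0 < logPhi x := by
  have m2 : (2:ℝ) ∈ Ioc (1:ℝ) (5/2) := by constructor <;> norm_num
  rcases lt_or_gt_of_ne h2 with h | h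
  · have := strictConvexOn_logPhi.slope_lt_of_hasDerivAt ⟨hx, hx'⟩ m2 h hasDerivAt_logPhi_two
    rw [slope_def_field, logPhi_two, div_lt_iff₀ (by linarith)] at this
    linarith
  · have := strictConvexOn_logPhi.lt_slope_of_hasDerivAt m2 ⟨hx, hx'⟩ h hasDerivAt_logPhi_two
    rw [slope_def_field, logPhi_two, lt_div_iff₀ (by linarith)] at this
    linarith

theorem logPhi_step_deriv_nonpos {x : ℝ} (hx : 5/2 ≤ x) :
    log (x + 1) - log (x + 2) + 1 / (x + 2) - (log (x - 1) - log x + 1 / x)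
      - (1 / (x + 2) + 1 / (x - 1/2) + 1 / (x + 1/2) - 1 / x - 2 * (1 / (x + 1))) ≤ 0 := by
  have h1 : 0 < x - 1 := by linarith
  have h2 : 0 < x := by linarith
  have h3 : 0 < x - 1/2 := by linarith
  have h4 : x * 2 - 1 ≠ 0 := by linarith
  have h5 : 0 ≤ x - 5/2 := by linarith
  have h6 : 0 < 3 * x ^ 2 + 3 * x - 2 := by nlinarith
  have hu : 0 ≤ 2 / ((x + 2) * (x - 1)) := by positivity
  have hl := log_one_add_le hu
  have e1 : 1 + 2 / ((x + 2) * (x - 1)) = (x + 1) * x / ((x + 2) * (x - 1)) := by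
    field_simp
    ring
  have e2 : 2 / ((x + 2) * (x - 1)) * (6 + 2 / ((x + 2) * (x - 1))) /
      (6 + 4 * (2 / ((x + 2) * (x - 1)))) =
      (6 * x ^ 2 + 6 * x - 10) / ((x + 2) * (x - 1) * (3 * x ^ 2 + 3 * x - 2)) := by
    have : 6 + 4 * (2 / ((x + 2) * (x - 1))) =
        2 * (3 * x ^ 2 + 3 * x - 2) / ((x + 2) * (x - 1)) := by
      field_simp
      ring
    rw [this]
    field_simp
    ring
  rw [e1, e2, log_div (by positivity) (by positivity), log_mul (by positivity) (by positivity),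
    log_mul (by positivity) (by positivity)] at hl
  have key : 1 / x + 1 / (x - 1/2) + 1 / (x + 1/2) - 1 / x - 2 * (1 / (x + 1))
      - (6 * x ^ 2 + 6 * x - 10) / ((x + 2) * (x - 1) * (3 * x ^ 2 + 3 * x - 2)) =
      (249/8 + 329/2 * (x - 5/2) + 158 * (x - 5/2) ^ 2 + 54 * (x - 5/2) ^ 3
        + 6 * (x - 5/2) ^ 4) / 4 /
      ((x + 2) * (x - 1) * (3 * x ^ 2 + 3 * x - 2) * (x - 1/2) * (x + 1/2) * (x + 1)) := by
    generalize hq : 3 * x ^ 2 + 3 * x - 2 = q at h6 ⊢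
    field_simp
    rw [← hq]
    ring
  have hpos : 0 ≤ (249/8 + 329/2 * (x - 5/2) + 158 * (x - 5/2) ^ 2 + 54 * (x - 5/2) ^ 3
        + 6 * (x - 5/2) ^ 4) / 4 /
      ((x + 2) * (x - 1) * (3 * x ^ 2 + 3 * x - 2) * (x - 1/2) * (x + 1/2) * (x + 1)) := by
    positivity
  linarith

theorem monotoneOn_logPhi : MonotoneOn logPhi (Ici (5/2)) := by
  refine monotoneOn_of_antitoneOn_step tendsto_logPhi ?_
  have hd : ∀ x ∈ Ici (5/2 : ℝ), HasDerivAt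
      (fun x => (x + 1) * (log (x + 1) - log (x + 2)) - (x - 1) * (log (x - 1) - log x)
        - logGammaQuotStep x)
      (log (x + 1) - log (x + 2) + 1 / (x + 2) - (log (x - 1) - log x + 1 / x)
        - (1 / (x + 2) + 1 / (x - 1/2) + 1 / (x + 1/2) - 1 / x - 2 * (1 / (x + 1)))) x := by
    intro x hx
    rw [mem_Ici] at hx
    have hx0 : x ≠ 0 := by linarith
    have hx1 : x - 1 ≠ 0 := by linarith
    have hx2 : x + 1 ≠ 0 := by linarith
    have hx3 : x + 2 ≠ 0 := by linarith
    have h1 := hasDerivAt_logGammaQuotStep (show 1/2 < x by linarith)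
    have h2 : HasDerivAt (fun x : ℝ => x - 1) 1 x := (hasDerivAt_id x).sub_const 1
    have h3 : HasDerivAt (fun x : ℝ => x + 1) 1 x := (hasDerivAt_id x).add_const 1
    have h4 := h2.fun_mul ((h2.log hx1).fun_sub (hasDerivAt_log hx0))
    have h5 := h3.fun_mul ((h3.log hx2).fun_sub (hasDerivAt_log_add 2 hx3))
    refine ((h5.fun_sub h4).fun_sub h1).congr_deriv ?_
    congr 1
    field_simp
    ring
  have hanti := antitoneOn_of_hasDerivWithinAt_nonpos (convex_Ici (5/2))
    (fun x hx => (hd x hx).continuousAt.continuousWithinAt)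
    (fun x hx => (hd x (interior_subset hx)).hasDerivWithinAt)
    (fun x hx => logPhi_step_deriv_nonpos (interior_subset hx))
  refine hanti.congr fun x hx => ?_
  rw [mem_Ici] at hx
  have := logGammaQuot_sub_add_two (show 1 < x by linarith)
  simp only [logPhi]
  rw [← this, show x + 2 - 1 = x + 1 by ring]
  ring

theorem stmt_2 :
    (∀ x : ℝ, 1 < x → x ≠ 2 → Phi x > 1) ∧ Phi 2 = 1 := by
  refine ⟨fun x hx h2 => ?_, Phi_two⟩
  rw [Phi_eq_exp_logPhi hx, gt_iff_lt, one_lt_exp_iff]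
  rcases le_total x (5/2) with h | h
  · exact logPhi_pos_of_le hx h h2
  · exact (logPhi_pos_of_le (by norm_num) le_rfl (by norm_num)).trans_le
      (monotoneOn_logPhi self_mem_Ici h h)
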